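/- Let π = (d₀,...,d_{n-1}) and π' = (d'₀,...,d'_{n'-1}) be distinct non-increasing tree degree sequences with n ≤ n' and ∑_{i=0}^{j} d_i ≤ ∑_{i=0}^{j} d'_i for all j = 0,...,n-1. If G maximizes the largest Laplacian eigenvalue in 𝒯_π and G' maximizes it in 𝒯_{π'}, then λ(G) < λ(G'). -/

import Mathlib

open SimpleGraph Finset Matrix

/-- The degree of vertex `v`: the number of its neighbors. -/
noncomputable def gdeg {V : Type*} (G : SimpleGraph V) (v : V) : ℕ :=
  (G.neighborSet v).ncard

open scoped Classical in
/-- The Laplacian matrix `L = D - A` of a graph, with real entries. -/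
noncomputable def lap {V : Type*} [Fintype V] [DecidableEq V] (G : SimpleGraph V) :
    Matrix V V ℝ :=
  Matrix.of fun u v =>
    (if u = v then (gdeg G u : ℝ) else 0) - (if G.Adj u v then 1 else 0)

/-- `lam` is the largest Laplacian eigenvalue of `G`. -/
def IsMaxEig {V : Type*} [Fintype V] [DecidableEq V] (G : SimpleGraph V) (lam : ℝ) : Prop :=
  IsGreatest {μ : ℝ | ∃ f : V → ℝ, f ≠ 0 ∧ (lap G).mulVec f = μ • f} lam

/-- `G` is extremal for the degree sequence `π` (given as a function `ℕ → ℕ`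
supported on `[0, n)`): `G` is a tree on `n` vertices realizing `π` which
maximizes the largest Laplacian eigenvalue `lam` among all such trees. -/
def ExtremalFor (n : ℕ) (π : ℕ → ℕ) (G : SimpleGraph (Fin n)) (lam : ℝ) : Prop :=
  G.IsTree ∧ (∃ σ : Equiv.Perm (Fin n), ∀ w, gdeg G w = π (σ w)) ∧ IsMaxEig G lam ∧
    ∀ G'' : SimpleGraph (Fin n), G''.IsTree →
      (∃ σ : Equiv.Perm (Fin n), ∀ w, gdeg G'' w = π (σ w)) →
      ∀ lam'' : ℝ, IsMaxEig G'' lam'' → lam'' ≤ lam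

open scoped Classical in
noncomputable def nsum {V : Type*} [Fintype V] (G : SimpleGraph V) (w : V → V → ℝ) (u : V) : ℝ :=
  ∑ v, if G.Adj u v then w u v else 0

lemma gdeg_eq_nsum {V : Type*} [Fintype V] (G : SimpleGraph V) (u : V) :
    (gdeg G u : ℝ) = nsum G (fun _ _ => 1) u := by
  classical
  unfold gdeg nsum
  rw [Set.ncard_eq_toFinset_card']
  rw [Finset.sum_boole]
  congr 2
  ext v; simp

lemma nsum_add {V : Type*} [Fintype V] [DecidableEq V] (G : SimpleGraph V) {p q : V} (hpq : p ≠ q)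
    (hn : ¬ G.Adj p q) (w : V → V → ℝ) (u : V) :
    nsum (G ⊔ edge p q) w u = nsum G w u + (if u = p then w p q else 0)
      + (if u = q then w q p else 0) := by
  classical
  have hn' : ¬ G.Adj q p := fun h => hn h.symm
  have : nsum G w u + (if u = p then w p q else 0) + (if u = q then w q p else 0) =
      ∑ v, ((if G.Adj u v then w u v else 0) + (if v = q then (if u = p then w p q else 0) else 0)
       + (if v = p then (if u = q then w q p else 0) else 0)) := by
    unfold nsum
    simp only [Finset.sum_add_distrib, Finset.sum_ite_eq', Finset.mem_univ, if_true]
  rw [this, nsum]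
  refine Finset.sum_congr rfl fun v _ => ?_
  simp only [sup_adj, edge_adj]
  by_cases h1 : u = p <;> by_cases h2 : u = q <;> by_cases h3 : v = p <;> by_cases h4 : v = q <;>
    simp_all

lemma lap_mulVec {V : Type*} [Fintype V] [DecidableEq V] (G : SimpleGraph V) (x : V → ℝ) (u : V) :
    (lap G).mulVec x u = nsum G (fun u v => x u - x v) u := by
  classical
  have h := gdeg_eq_nsum G u
  unfold nsum at *
  unfold lap Matrix.mulVec dotProduct
  simp only [Matrix.of_apply, sub_mul, Finset.sum_sub_distrib, ite_mul, zero_mul, one_mul,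
    Finset.sum_ite_eq, Finset.mem_univ, if_true]
  rw [h, Finset.sum_mul, ← Finset.sum_sub_distrib]
  refine Finset.sum_congr rfl fun v _ => ?_
  split_ifs <;> simp

lemma lap_herm {V : Type*} [Fintype V] [DecidableEq V] (G : SimpleGraph V) :
    (lap G).IsHermitian := by
  ext u v
  simp only [lap, Matrix.conjTranspose_apply, Matrix.of_apply, star_trivial, G.adj_comm v u]
  by_cases h : u = v
  · subst h; rfl
  · by_cases h' : G.Adj u v
    · simp [h, Ne.symm h, h', h'.symm]
    · have h2 : ¬ G.Adj v u := fun h2 => h' h2.symm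
      simp [h, Ne.symm h, h', h2]

/-- the energy -/
noncomputable def en {V : Type*} [Fintype V] (G : SimpleGraph V) (f : V → ℝ) : ℝ :=
  ∑ u, nsum G (fun u v => (f u + f v) ^ 2) u

lemma lap_form {V : Type*} [Fintype V] [DecidableEq V] (G : SimpleGraph V) (x : V → ℝ) :
    2 * (x ⬝ᵥ (lap G).mulVec x) = ∑ u, nsum G (fun u v => (x u - x v) ^ 2) u := by
  classical
  have h1 : x ⬝ᵥ (lap G).mulVec x =
      ∑ u, ∑ v, if G.Adj u v then x u * (x u - x v) else 0 := by
    unfold dotProduct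
    refine Finset.sum_congr rfl fun u _ => ?_
    rw [lap_mulVec, nsum, Finset.mul_sum]
    refine Finset.sum_congr rfl fun v _ => ?_
    split_ifs <;> simp
  have h2 : x ⬝ᵥ (lap G).mulVec x =
      ∑ u, ∑ v, if G.Adj u v then x v * (x v - x u) else 0 := by
    rw [h1, Finset.sum_comm]
    refine Finset.sum_congr rfl fun u _ => Finset.sum_congr rfl fun v _ => ?_
    simp only [G.adj_comm]
  rw [two_mul]
  nth_rewrite 1 [h1]
  rw [h2, ← Finset.sum_add_distrib]
  unfold nsum
  refine Finset.sum_congr rfl fun u _ => ?_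
  rw [← Finset.sum_add_distrib]
  refine Finset.sum_congr rfl fun v _ => ?_
  split_ifs
  · ring
  · simp

lemma exists_sign {V : Type*} (G : SimpleGraph V) (hG : G.IsTree) :
    ∃ s : V → ℝ, (∀ u, s u * s u = 1) ∧ ∀ u v, G.Adj u v → s v = - s u := by
  obtain ⟨C⟩ := hG.colorable_two
  refine ⟨fun u => if C u = 0 then 1 else -1, fun u => by by_cases h : C u = 0 <;> simp [h], ?_⟩
  intro u v h
  have hne := C.valid h
  by_cases h1 : C u = 0 <;> by_cases h2 : C v = 0
  · exact absurd (h1.trans h2.symm) hne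
  · simp [h1, h2]
  · simp [h1, h2]
  · exfalso; omega

lemma sign_lap {V : Type*} [Fintype V] [DecidableEq V] (G : SimpleGraph V) (s f : V → ℝ)
    (hs : ∀ u v, G.Adj u v → s v = - s u) (u : V) :
    (lap G).mulVec (fun u => s u * f u) u = s u * nsum G (fun u v => f u + f v) u := by
  rw [lap_mulVec, nsum, nsum, Finset.mul_sum]
  refine Finset.sum_congr rfl fun v _ => ?_
  split_ifs with h
  · rw [hs u v h]; ring
  · simp

lemma sign_form {V : Type*} [Fintype V] [DecidableEq V] (G : SimpleGraph V) (s f : V → ℝ)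
    (hs1 : ∀ u, s u * s u = 1)
    (hs : ∀ u v, G.Adj u v → s v = - s u) :
    2 * ((fun u => s u * f u) ⬝ᵥ (lap G).mulVec (fun u => s u * f u)) = en G f := by
  rw [lap_form, en]
  refine Finset.sum_congr rfl fun u _ => ?_
  rw [nsum, nsum]
  refine Finset.sum_congr rfl fun v _ => ?_
  split_ifs with h
  · rw [hs u v h]; linear_combination (f u + f v)^2 * hs1 u
  · simp

lemma sign_norm {V : Type*} [Fintype V] (s f : V → ℝ) (hs1 : ∀ u, s u * s u = 1) :
    (fun u => s u * f u) ⬝ᵥ (fun u => s u * f u) = ∑ u, f u ^ 2 := by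
  unfold dotProduct
  refine Finset.sum_congr rfl fun u _ => ?_
  linear_combination (f u)^2 * hs1 u

lemma exists_max {V : Type*} [Fintype V] [DecidableEq V] [Nonempty V] (G : SimpleGraph V) :
    ∃ lam, IsMaxEig G lam := by
  have hM := lap_herm G
  obtain ⟨i, -, hi⟩ := Finset.exists_max_image (Finset.univ : Finset V) hM.eigenvalues
    Finset.univ_nonempty
  refine ⟨hM.eigenvalues i, ⟨hM.eigenvectorBasis i, ?_, ?_⟩, ?_⟩
  · intro h
    apply hM.eigenvectorBasis.orthonormal.ne_zero i
    ext j; exact congrFun h j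
  · exact hM.mulVec_eigenvectorBasis i
  · rintro μ ⟨f, hf, hμ⟩
    have h1 : Module.End.HasEigenvalue (Matrix.toLin' (lap G)) μ := by
      apply Module.End.hasEigenvalue_of_hasEigenvector (x := f)
      refine ⟨Module.End.mem_eigenspace_iff.2 ?_, hf⟩
      rw [Matrix.toLin'_apply, hμ]
    have h2 := h1.mem_spectrum
    rw [Matrix.spectrum_toLin', hM.spectrum_real_eq_range_eigenvalues] at h2
    obtain ⟨j, rfl⟩ := h2
    exact hi j (Finset.mem_univ _)

lemma psd_of_max {V : Type*} [Fintype V] [DecidableEq V] (G : SimpleGraph V) (lam : ℝ)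
    (h : IsMaxEig G lam) : (lam • (1 : Matrix V V ℝ) - lap G).PosSemidef := by
  have hM : (lam • (1 : Matrix V V ℝ) - lap G).IsHermitian := by
    refine Matrix.IsHermitian.sub ?_ (lap_herm G)
    ext u v
    simp [Matrix.one_apply, eq_comm]
  rw [hM.posSemidef_iff_eigenvalues_nonneg]
  intro i
  have := hM.mulVec_eigenvectorBasis i
  rw [Matrix.sub_mulVec, Matrix.smul_mulVec, Matrix.one_mulVec] at this
  have h3 : lam - hM.eigenvalues i ≤ lam := by
    apply h.2
    refine ⟨hM.eigenvectorBasis i, ?_, ?_⟩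
    · intro h
      apply hM.eigenvectorBasis.orthonormal.ne_zero i
      ext j; exact congrFun h j
    · rw [sub_smul, ← this]; simp
  simp only [Pi.zero_apply]; linarith

lemma form_le {V : Type*} [Fintype V] [DecidableEq V] (G : SimpleGraph V) (lam : ℝ)
    (h : IsMaxEig G lam) (x : V → ℝ) : x ⬝ᵥ (lap G).mulVec x ≤ lam * (x ⬝ᵥ x) := by
  have := (psd_of_max G lam h).dotProduct_mulVec_nonneg x
  rw [Matrix.sub_mulVec, Matrix.smul_mulVec, Matrix.one_mulVec, dotProduct_sub,
    dotProduct_smul] at this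
  simpa using this

lemma form_eq {V : Type*} [Fintype V] [DecidableEq V] (G : SimpleGraph V) (lam : ℝ)
    (h : IsMaxEig G lam) (x : V → ℝ) (hx : lam * (x ⬝ᵥ x) ≤ x ⬝ᵥ (lap G).mulVec x) :
    (lap G).mulVec x = lam • x := by
  have h1 := form_le G lam h x
  have := ((psd_of_max G lam h).dotProduct_mulVec_zero_iff x).1 (by
    rw [Matrix.sub_mulVec, Matrix.smul_mulVec, Matrix.one_mulVec, dotProduct_sub,
      dotProduct_smul]
    simp only [star_trivial, smul_eq_mul]; linarith)
  rw [Matrix.sub_mulVec, Matrix.smul_mulVec, Matrix.one_mulVec] at this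
  exact (sub_eq_zero.1 this).symm

lemma en_le {V : Type*} [Fintype V] [DecidableEq V] (G : SimpleGraph V) (hG : G.IsTree) (lam : ℝ)
    (h : IsMaxEig G lam) (f : V → ℝ) : en G f ≤ 2 * (lam * ∑ u, f u ^ 2) := by
  obtain ⟨s, h1, h2⟩ := exists_sign G hG
  have := form_le G lam h (fun u => s u * f u)
  rw [sign_norm s f h1] at this
  linarith [sign_form G s f h1 h2]

lemma en_eq {V : Type*} [Fintype V] [DecidableEq V] (G : SimpleGraph V) (hG : G.IsTree) (lam : ℝ)
    (h : IsMaxEig G lam) (f : V → ℝ) (hf : 2 * (lam * ∑ u, f u ^ 2) ≤ en G f) (u : V) :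
    nsum G (fun u v => f u + f v) u = lam * f u := by
  obtain ⟨s, h1, h2⟩ := exists_sign G hG
  have := form_eq G lam h (fun u => s u * f u) (by
    rw [sign_norm s f h1]
    linarith [sign_form G s f h1 h2])
  have := congrFun this u
  rw [sign_lap G s f h2] at this
  simp only [Pi.smul_apply, smul_eq_mul] at this
  have h3 : s u ≠ 0 := fun h => by have := h1 u; simp [h] at this
  apply mul_left_cancel₀ h3
  linarith

lemma perron {V : Type*} [Fintype V] [DecidableEq V] (G : SimpleGraph V) (hG : G.IsTree) (lam : ℝ)
    (h : IsMaxEig G lam) : ∃ f : V → ℝ, (∀ u, 0 < f u) ∧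
      (∀ u, nsum G (fun u v => f u + f v) u = lam * f u) ∧ en G f = 2 * (lam * ∑ u, f u ^ 2) := by
  obtain ⟨f, hf, he⟩ := h.1
  have hE : 2 * (lam * ∑ u, |f u| ^ 2) ≤ en G (fun u => |f u|) := by
    have := lap_form G f
    rw [he, dotProduct_smul] at this
    have h0 : f ⬝ᵥ f = ∑ u, |f u| ^ 2 := by
      unfold dotProduct
      refine Finset.sum_congr rfl fun u _ => ?_
      rw [sq_abs, sq]
    rw [h0, smul_eq_mul] at this
    rw [this, en]
    refine Finset.sum_le_sum fun u _ => Finset.sum_le_sum fun v _ => ?_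
    split_ifs
    · rw [sq_le_sq, abs_of_nonneg (a := |f u| + |f v|) (by positivity)]
      exact abs_sub _ _
    · rfl
  have hq := en_eq G hG lam h _ hE
  refine ⟨fun u => |f u|, ?_, hq, le_antisymm (en_le G hG lam h _) hE⟩
  by_contra! hneg
  obtain ⟨u, hu⟩ := hneg
  apply hf
  have hstep : ∀ a b, G.Adj a b → f a = 0 → f b = 0 := by
    intro a b hab ha
    have h1 := hq a
    simp only [ha, abs_zero, mul_zero, nsum, zero_add] at h1
    rw [Finset.sum_eq_zero_iff_of_nonneg (fun v _ => by split_ifs <;> positivity)] at h1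
    simpa [hab] using h1 b (Finset.mem_univ _)
  have hwalk : ∀ a b, G.Walk a b → f a = 0 → f b = 0 := by
    intro a b p
    induction p with
    | nil => exact id
    | cons hab _ ih => exact fun h => ih (hstep _ _ hab h)
  funext v
  obtain ⟨p⟩ := hG.connected u v
  exact hwalk u v p (by simpa using hu)

lemma improve {V : Type*} [Fintype V] [DecidableEq V] (G : SimpleGraph V) (hG : G.IsTree) (lam : ℝ)
    (g : V → ℝ) (hg0 : ∃ u, g u ≠ 0) (hE : 2 * (lam * ∑ u, g u ^ 2) ≤ en G g)
    (hn : ∃ u, nsum G (fun u v => g u + g v) u ≠ lam * g u) :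
    ∃ lam', IsMaxEig G lam' ∧ lam < lam' := by
  obtain ⟨u0, hu0⟩ := hg0
  have : Nonempty V := ⟨u0⟩
  obtain ⟨lam', h'⟩ := exists_max G
  refine ⟨lam', h', ?_⟩
  by_contra! hle
  have hpos : 0 < ∑ u, g u ^ 2 :=
    Finset.sum_pos' (fun _ _ => sq_nonneg _) ⟨u0, Finset.mem_univ _, by positivity⟩
  have h1 := en_le G hG lam' h' g
  have h2 : lam' = lam := by
    apply le_antisymm hle
    have : lam * ∑ u, g u ^ 2 ≤ lam' * ∑ u, g u ^ 2 := by linarith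
    exact le_of_mul_le_mul_right this hpos
  subst h2
  obtain ⟨u, hu⟩ := hn
  exact hu (en_eq G hG _ h' g hE u)

lemma one_move {V : Type*} [Fintype V] [DecidableEq V] (G : SimpleGraph V) (hG : G.IsTree)
    {a b : V} (hab : a ≠ b) (hb : 2 ≤ gdeg G b) :
    ∃ x, x ≠ a ∧ x ≠ b ∧ ∃ G' : SimpleGraph V, G'.IsTree ∧ ∀ w u, nsum G' w u =
      nsum G w u + (if u = a then w a x else 0) + (if u = x then w x a else 0)
       - (if u = b then w b x else 0) - (if u = x then w x b else 0) := by
  classical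
  obtain ⟨p, hp⟩ := (hG.connected b a).exists_isPath
  cases p with
  | nil => exact absurd rfl hab
  | @cons _ y _ hby p' =>
    rw [Walk.cons_isPath_iff] at hp
    obtain ⟨hp', hbp⟩ := hp
    obtain ⟨x, hx, hxy⟩ : ∃ x, G.Adj b x ∧ x ≠ y := by
      obtain ⟨x, hx, hxy⟩ := Set.exists_ne_of_one_lt_ncard (s := G.neighborSet b) hb y
      exact ⟨x, hx, hxy⟩
    set G0 := G \ edge b x with hG0
    have hle : G0 ≤ G := sdiff_le
    have hG0adj : ∀ u v, G.Adj u v → s(u, v) ≠ s(b, x) → G0.Adj u v := by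
      intro u v huv hne
      rw [hG0, sdiff_adj]
      refine ⟨huv, fun h => hne ?_⟩
      rw [adj_edge] at h
      exact h.1.symm
    have hbr : ¬ G0.Reachable b x := by
      have := isAcyclic_iff_forall_adj_isBridge.1 hG.isAcyclic hx
      rw [isBridge_iff] at this
      exact this
    have hya : G0.Reachable y a := by
      refine ⟨p'.transfer G0 ?_⟩
      intro e he
      induction e with
      | _ u v =>
        apply hG0adj u v (p'.adj_of_mem_edges he)
        intro h
        rw [h] at he
        exact hbp (p'.fst_mem_support_of_mem_edges he)
    have hba : G0.Reachable b a := by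
      refine Reachable.trans (Adj.reachable (hG0adj b y hby ?_)) hya
      intro h
      simp only [Sym2.eq_iff] at h
      rcases h with h | h
      · exact hxy h.2.symm
      · exact hby.ne h.2.symm
    have hax : ¬ G0.Reachable a x := fun h => hbr (hba.trans h)
    have hxa : x ≠ a := by rintro rfl; exact hbr hba
    have hxb : x ≠ b := hx.ne'
    refine ⟨x, hxa, hxb, G0 ⊔ edge a x, ⟨?_, ?_⟩, ?_⟩
    · have hle' : G0 ≤ G0 ⊔ edge a x := le_sup_left
      have hbx : (G0 ⊔ edge a x).Reachable b x := by
        refine (hba.mono hle').trans (Adj.reachable ?_)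
        rw [sup_adj, edge_adj]
        right; exact ⟨Or.inl ⟨rfl, rfl⟩, hxa.symm⟩
      have hstep : ∀ u v, G.Adj u v → (G0 ⊔ edge a x).Reachable u v := by
        intro u v huv
        by_cases h : s(u, v) = s(b, x)
        · rw [Sym2.eq_iff] at h
          rcases h with ⟨rfl, rfl⟩ | ⟨rfl, rfl⟩
          · exact hbx
          · exact hbx.symm
        · exact (Adj.reachable (hG0adj u v huv h)).mono hle'
      have hwalk : ∀ u v, G.Walk u v → (G0 ⊔ edge a x).Reachable u v := by
        intro u v p
        induction p with
        | nil => exact Reachable.refl _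
        | cons h _ ih => exact (hstep _ _ h).trans ih
      have := hG.connected.nonempty
      refine ⟨fun u v => ?_⟩
      obtain ⟨p⟩ := hG.connected u v
      exact hwalk u v p
    · exact IsAcyclic.sup_edge_of_not_reachable hax (hG.isAcyclic.anti hle)
    · intro w u
      have h1 : G = G0 ⊔ edge b x := by
        rw [hG0]
        refine (sdiff_sup_cancel ?_).symm
        intro u v h
        rw [edge_adj] at h
        rcases h.1 with ⟨rfl, rfl⟩ | ⟨rfl, rfl⟩
        · exact hx
        · exact hx.symm
      have h2 := nsum_add G0 hxb.symm (fun h => hbr h.reachable) w u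
      rw [← h1] at h2
      rw [nsum_add G0 hxa.symm (fun h => hax h.reachable) w u, h2]
      ring

lemma moves {V : Type*} [Fintype V] [DecidableEq V] {a b : V} (hab : a ≠ b) (f : V → ℝ)
    (hf : ∀ u, 0 < f u) (hfab : f b ≤ f a) (k : ℕ) : ∀ (G : SimpleGraph V), G.IsTree →
    k + 1 ≤ gdeg G b →
    ∃ G' : SimpleGraph V, G'.IsTree ∧ gdeg G' a = gdeg G a + k ∧ gdeg G' b + k = gdeg G b ∧
      (∀ u, u ≠ a → u ≠ b → gdeg G' u = gdeg G u) ∧ en G f ≤ en G' f ∧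
      nsum G (fun u v => f u + f v) a ≤ nsum G' (fun u v => f u + f v) a ∧
      (0 < k → nsum G (fun u v => f u + f v) a < nsum G' (fun u v => f u + f v) a) := by
  induction k with
  | zero => exact fun G hG _ => ⟨G, hG, by simp⟩
  | succ k ih =>
    intro G hG hk
    obtain ⟨x, hxa, hxb, G1, hG1, hs⟩ := one_move G hG hab (by omega)
    have hda : gdeg G1 a = gdeg G a + 1 := by
      have := hs (fun _ _ => 1) a
      rw [← gdeg_eq_nsum, ← gdeg_eq_nsum] at this
      simp [hab, hxa.symm] at this
      exact_mod_cast this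
    have hdb : gdeg G1 b + 1 = gdeg G b := by
      have := hs (fun _ _ => 1) b
      rw [← gdeg_eq_nsum, ← gdeg_eq_nsum] at this
      simp [hab.symm, hxb.symm] at this
      have : (gdeg G1 b : ℝ) + 1 = gdeg G b := by linarith
      exact_mod_cast this
    have hdu : ∀ u, u ≠ a → u ≠ b → gdeg G1 u = gdeg G u := by
      intro u hua hub
      have := hs (fun _ _ => 1) u
      rw [← gdeg_eq_nsum, ← gdeg_eq_nsum] at this
      simp [hua, hub] at this
      exact_mod_cast this
    have hE : en G f ≤ en G1 f := by
      unfold en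
      simp only [hs, Finset.sum_add_distrib, Finset.sum_sub_distrib, Finset.sum_ite_eq',
        Finset.mem_univ, if_true]
      have := hf x; have := hf a; have := hf b
      nlinarith [mul_nonneg (sub_nonneg.2 hfab) (by linarith : 0 ≤ f a + f b + 2 * f x)]
    have hQ : nsum G (fun u v => f u + f v) a < nsum G1 (fun u v => f u + f v) a := by
      rw [hs]
      simp only [hab, hxa.symm, if_true, if_false]
      have := hf x; have := hf a
      linarith
    obtain ⟨G', h1, h2, h3, h4, h5, h6, -⟩ := ih G1 hG1 (by omega)
    refine ⟨G', h1, by omega, by omega, fun u hu hu' => (h4 u hu hu').trans (hdu u hu hu'),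
      hE.trans h5, hQ.le.trans h6, fun _ => hQ.trans_le h6⟩

lemma move_improve {V : Type*} [Fintype V] [DecidableEq V] {a b : V} (hab : a ≠ b)
    (G : SimpleGraph V) (hG : G.IsTree) (lam : ℝ) (f : V → ℝ)
    (hf : ∀ u, 0 < f u) (hq : ∀ u, nsum G (fun u v => f u + f v) u = lam * f u)
    (hE : en G f = 2 * (lam * ∑ u, f u ^ 2)) (hfab : f b ≤ f a) (k : ℕ) (hk0 : 0 < k)
    (hk : k + 1 ≤ gdeg G b) :
    ∃ G' : SimpleGraph V, G'.IsTree ∧ gdeg G' a = gdeg G a + k ∧ gdeg G' b + k = gdeg G b ∧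
      (∀ u, u ≠ a → u ≠ b → gdeg G' u = gdeg G u) ∧ ∃ lam', IsMaxEig G' lam' ∧ lam < lam' := by
  obtain ⟨G', h1, h2, h3, h4, h5, h6, h7⟩ := moves hab f hf hfab k G hG hk
  refine ⟨G', h1, h2, h3, h4, improve G' h1 lam f ⟨a, (hf a).ne'⟩ (hE ▸ h5) ⟨a, ?_⟩⟩
  have := h7 hk0
  rw [hq] at this
  exact this.ne'

/-- `G` realizes `π`. -/
def Realizes (n : ℕ) (π : ℕ → ℕ) (G : SimpleGraph (Fin n)) : Prop :=
  ∃ σ : Equiv.Perm (Fin n), ∀ w, gdeg G w = π (σ w)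

lemma transfer_step (n : ℕ) (π π1 : ℕ → ℕ) (i j : ℕ) (hi : i < n) (hj : j < n) (hij : i ≠ j)
    (hd : π j ≤ π i) (hd2 : 2 ≤ π j) (h1i : π1 i = π i + 1) (h1j : π1 j + 1 = π j)
    (h1 : ∀ k, k ≠ i → k ≠ j → π1 k = π k)
    (G : SimpleGraph (Fin n)) (hG : G.IsTree) (hr : Realizes n π G) (lam : ℝ)
    (hlam : IsMaxEig G lam) :
    ∃ G' : SimpleGraph (Fin n), G'.IsTree ∧ Realizes n π1 G' ∧
      ∃ lam', IsMaxEig G' lam' ∧ lam < lam' := by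
  obtain ⟨σ, hσ⟩ := hr
  obtain ⟨f, hf, hq, hE⟩ := perron G hG lam hlam
  obtain ⟨a, ha⟩ := σ.surjective ⟨i, hi⟩
  obtain ⟨b, hb⟩ := σ.surjective ⟨j, hj⟩
  have hab : a ≠ b := by
    rintro rfl
    rw [ha] at hb
    exact hij (congrArg Fin.val hb)
  have hga : gdeg G a = π i := by rw [hσ, ha]
  have hgb : gdeg G b = π j := by rw [hσ, hb]
  have hne : ∀ w, w ≠ a → w ≠ b → ((σ w : ℕ) ≠ i ∧ (σ w : ℕ) ≠ j) := by
    intro w hwa hwb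
    constructor
    · intro h; exact hwa (σ.injective (by rw [ha]; exact Fin.ext h))
    · intro h; exact hwb (σ.injective (by rw [hb]; exact Fin.ext h))
  rcases le_total (f b) (f a) with hfab | hfab
  · obtain ⟨G', t, e1, e2, e3, l⟩ := move_improve hab G hG lam f hf hq hE hfab 1 one_pos (by omega)
    refine ⟨G', t, ⟨σ, fun w => ?_⟩, l⟩
    by_cases hwa : w = a
    · subst hwa; rw [ha]; simp only; omega
    by_cases hwb : w = b
    · subst hwb; rw [hb]; simp only; omega
    rw [e3 w hwa hwb, hσ, h1 _ (hne w hwa hwb).1 (hne w hwa hwb).2]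
  · obtain ⟨G', t, e1, e2, e3, l⟩ := move_improve hab.symm G hG lam f hf hq hE hfab
      (π i - π j + 1) (by omega) (by omega)
    refine ⟨G', t, ⟨(Equiv.swap a b).trans σ, fun w => ?_⟩, l⟩
    by_cases hwa : w = a
    · subst hwa; simp only [Equiv.trans_apply, Equiv.swap_apply_left, hb]; omega
    by_cases hwb : w = b
    · subst hwb; simp only [Equiv.trans_apply, Equiv.swap_apply_right, ha]; omega
    rw [Equiv.trans_apply, Equiv.swap_apply_of_ne_of_ne hwa hwb]
    rw [e3 w hwb hwa, hσ, h1 _ (hne w hwa hwb).1 (hne w hwa hwb).2]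

lemma two_card_edges {V : Type*} [Fintype V] (G : SimpleGraph V) :
    2 * Nat.card G.edgeSet = ∑ u, gdeg G u := by
  classical
  rw [Nat.card_eq_fintype_card, ← edgeFinset_card, ← G.sum_degrees_eq_twice_card_edges]
  refine Finset.sum_congr rfl fun u _ => ?_
  rw [gdeg, Set.ncard_eq_toFinset_card']
  rfl

lemma pendant_step (n : ℕ) (π π1 : ℕ → ℕ) (i : ℕ) (hi : i < n) (h1i : π1 i = π i + 1)
    (h1n : π1 n = 1) (h1 : ∀ k, k < n → k ≠ i → π1 k = π k)
    (G : SimpleGraph (Fin n)) (hG : G.IsTree) (hr : Realizes n π G) (lam : ℝ)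
    (hlam : IsMaxEig G lam) :
    ∃ G' : SimpleGraph (Fin (n + 1)), G'.IsTree ∧ Realizes (n + 1) π1 G' ∧
      ∃ lam', IsMaxEig G' lam' ∧ lam < lam' := by
  classical
  obtain ⟨σ, hσ⟩ := hr
  obtain ⟨f, hf, hq, hE⟩ := perron G hG lam hlam
  obtain ⟨a, ha⟩ := σ.surjective ⟨i, hi⟩
  set H : SimpleGraph (Fin (n + 1)) := G.map Fin.castSuccEmb with hH
  have hHadj : ∀ u v : Fin n, H.Adj u.castSucc v.castSucc ↔ G.Adj u v := fun u v =>
    map_adj_apply (f := Fin.castSuccEmb)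
  have hHlast : ∀ u, ¬ H.Adj (Fin.last n) u := by
    intro u h
    rw [hH, map_adj] at h
    obtain ⟨x, y, -, hx, -⟩ := h
    exact (Fin.castSucc_lt_last x).ne hx
  have hHlast' : ∀ u, ¬ H.Adj u (Fin.last n) := fun u h => hHlast u h.symm
  have hH1 : ∀ w u, nsum H w (Fin.castSucc u) =
      nsum G (fun u v => w (Fin.castSucc u) (Fin.castSucc v)) u := by
    intro w u
    simp only [nsum, Fin.sum_univ_castSucc, hHadj, hHlast', if_false, add_zero]
  have hH2 : ∀ w, nsum H w (Fin.last n) = 0 := by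
    intro w
    simp only [nsum, hHlast, if_false, Finset.sum_const_zero]
  set G' : SimpleGraph (Fin (n + 1)) := H ⊔ edge a.castSucc (Fin.last n) with hG'
  have hal : a.castSucc ≠ Fin.last n := (Fin.castSucc_lt_last a).ne
  have hs := nsum_add H hal (hHlast' _)
  have hG1 : ∀ w u, nsum G' w (Fin.castSucc u) =
      nsum G (fun u v => w (Fin.castSucc u) (Fin.castSucc v)) u +
       (if u = a then w a.castSucc (Fin.last n) else 0) := by
    intro w u
    rw [hs, hH1]
    simp [(Fin.castSucc_lt_last u).ne]
  have hG2 : ∀ w, nsum G' w (Fin.last n) = w (Fin.last n) a.castSucc := by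
    intro w
    rw [hs, hH2]
    simp [hal.symm]
  have hd1 : ∀ u : Fin n, gdeg G' u.castSucc = gdeg G u + if u = a then 1 else 0 := by
    intro u
    have := hG1 (fun _ _ => 1) u
    rw [← gdeg_eq_nsum, ← gdeg_eq_nsum] at this
    exact_mod_cast this
  have hd2 : gdeg G' (Fin.last n) = 1 := by
    have := hG2 (fun _ _ => 1)
    rw [← gdeg_eq_nsum] at this
    exact_mod_cast this
  have htree : G'.IsTree := by
    rw [isTree_iff_connected_and_card]
    constructor
    · have hadj : G'.Adj a.castSucc (Fin.last n) := by
        rw [hG', sup_adj, edge_adj]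
        right; exact ⟨Or.inl ⟨rfl, rfl⟩, hal⟩
      have hwalk : ∀ u v, G.Walk u v → G'.Reachable u.castSucc v.castSucc := by
        intro u v p
        induction p with
        | nil => exact Reachable.refl _
        | cons h _ ih =>
          refine Reachable.trans (Adj.reachable ?_) ih
          rw [hG', sup_adj]
          exact Or.inl ((hHadj _ _).2 h)
      have hall : ∀ u, G'.Reachable a.castSucc u := by
        intro u
        induction u using Fin.lastCases with
        | last => exact hadj.reachable
        | cast u =>
          obtain ⟨p⟩ := hG.connected a u
          exact hwalk _ _ p
      exact ⟨fun u v => (hall u).symm.trans (hall v)⟩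
    · have e1 := two_card_edges G'
      have e2 := two_card_edges G
      have e3 := (isTree_iff_connected_and_card.1 hG).2
      rw [Fin.sum_univ_castSucc, hd2] at e1
      simp only [hd1, Finset.sum_add_distrib, Finset.sum_ite_eq', Finset.mem_univ, if_true] at e1
      simp only [Nat.card_eq_fintype_card (α := Fin _), Fintype.card_fin] at e3 ⊢
      omega
  refine ⟨G', htree, ?_, ?_⟩
  · let τ : Fin (n + 1) → Fin (n + 1) :=
      Fin.lastCases (Fin.last n) (fun u => (σ u).castSucc)
    have τ1 : τ (Fin.last n) = Fin.last n := by simp [τ]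
    have τ2 : ∀ u : Fin n, τ u.castSucc = (σ u).castSucc := by intro u; simp [τ]
    have hinj : Function.Injective τ := by
      intro u v h
      induction u using Fin.lastCases with
      | last =>
        induction v using Fin.lastCases with
        | last => rfl
        | cast v =>
          rw [τ1, τ2] at h
          exact absurd h.symm (Fin.castSucc_lt_last _).ne
      | cast u =>
        induction v using Fin.lastCases with
        | last =>
          rw [τ1, τ2] at h
          exact absurd h (Fin.castSucc_lt_last _).ne
        | cast v =>
          rw [τ2, τ2] at h
          rw [σ.injective (Fin.castSucc_injective _ h)]
    refine ⟨Equiv.ofBijective τ (Finite.injective_iff_bijective.1 hinj), fun w => ?_⟩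
    rw [Equiv.ofBijective_apply]
    induction w using Fin.lastCases with
    | last => rw [τ1, hd2]; simp [h1n]
    | cast u =>
      rw [τ2, hd1, hσ]
      by_cases hu : u = a
      · subst hu; simp [ha, h1i]
      · have : (σ u : ℕ) ≠ i := fun h => hu (σ.injective (by rw [ha]; exact Fin.ext h))
        simp [hu, h1 _ (σ u).2 this]
  · let g : Fin (n + 1) → ℝ := Fin.lastCases 0 f
    have g1 : g (Fin.last n) = 0 := by simp [g]
    have g2 : ∀ u : Fin n, g u.castSucc = f u := by intro u; simp [g]
    have hfa := hf a
    refine improve G' htree lam g ⟨a.castSucc, by rw [g2]; exact hfa.ne'⟩ ?_ ⟨Fin.last n, ?_⟩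
    · rw [en] at *
      simp only [Fin.sum_univ_castSucc, g1, g2, hG1, hG2, Finset.sum_add_distrib,
        Finset.sum_ite_eq', Finset.mem_univ, if_true]
      nlinarith [sq_nonneg (f a)]
    · rw [hG2, g1, g2]
      simpa using hfa.ne'

def ps (π : ℕ → ℕ) (k : ℕ) : ℕ := ∑ i ∈ Finset.range k, π i

lemma ps_succ (π : ℕ → ℕ) (k : ℕ) : ps π (k + 1) = ps π k + π k := Finset.sum_range_succ _ _

lemma ps_zero (π : ℕ → ℕ) : ps π 0 = 0 := rfl

lemma chain_same (n : ℕ) (π' : ℕ → ℕ) (hs' : ∀ i, 0 < π' i ↔ i < n)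
    (hm' : ∀ i, π' (i + 1) ≤ π' i) (m : ℕ) : ∀ (π : ℕ → ℕ), (∀ i, 0 < π i ↔ i < n) →
    (∀ i, π (i + 1) ≤ π i) → (∀ j ≤ n, ps π j ≤ ps π' j) → ps π n = ps π' n → π ≠ π' →
    ∑ k ∈ Finset.range (n + 1), (ps π' k - ps π k) = m →
    ∀ (G : SimpleGraph (Fin n)), G.IsTree → Realizes n π G → ∀ lam, IsMaxEig G lam →
    ∃ G' : SimpleGraph (Fin n), G'.IsTree ∧ Realizes n π' G' ∧
      ∃ lam', IsMaxEig G' lam' ∧ lam < lam' := by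
  induction m using Nat.strong_induction_on with
  | _ m ih =>
  intro π hs hm hmaj htot hne hmeas G hG hr lam hlam
  have hex : ∃ i, π i ≠ π' i := by
    by_contra! h
    exact hne (funext h)
  obtain ⟨i, hi, himin⟩ : ∃ i, π i ≠ π' i ∧ ∀ k < i, π k = π' k :=
    ⟨Nat.find hex, Nat.find_spec hex, fun k hk => not_not.1 (Nat.find_min hex hk)⟩
  have hin : i < n := by
    by_contra h
    have h1 := hs i
    have h2 := hs' i
    omega
  have hSi : ps π i = ps π' i := Finset.sum_congr rfl fun k hk => himin k (Finset.mem_range.1 hk)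
  have hi' : π i < π' i := by
    have := hmaj (i + 1) hin
    rw [ps_succ, ps_succ] at this
    omega
  have hex2 : ∃ j, i < j ∧ ps π (j + 1) = ps π' (j + 1) := by
    refine ⟨n - 1, ?_, ?_⟩
    · by_contra h
      have h1 : i + 1 = n := by omega
      have h2 := ps_succ π i
      have h3 := ps_succ π' i
      rw [h1] at h2 h3
      omega
    · rw [Nat.sub_add_cancel (by omega)]; exact htot
  obtain ⟨j, ⟨hij, hj⟩, hjmin⟩ : ∃ j, (i < j ∧ ps π (j + 1) = ps π' (j + 1)) ∧
      ∀ k < j, ¬ (i < k ∧ ps π (k + 1) = ps π' (k + 1)) :=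
    ⟨Nat.find hex2, Nat.find_spec hex2, fun k hk => Nat.find_min hex2 hk⟩
  have hjn : j < n := by
    by_contra h
    refine hjmin (n - 1) (by omega) ⟨?_, ?_⟩
    · by_contra h
      have h1 : i + 1 = n := by omega
      have h2 := ps_succ π i
      have h3 := ps_succ π' i
      rw [h1] at h2 h3
      omega
    · rw [Nat.sub_add_cancel (by omega)]; exact htot
  have hstrict : ∀ k, i < k → k ≤ j → ps π k < ps π' k := by
    intro k hk1 hk2
    obtain ⟨k, rfl⟩ : ∃ l, k = l + 1 := ⟨k - 1, by omega⟩
    by_cases hki : k = i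
    · subst hki; rw [ps_succ, ps_succ]; omega
    · have h1 := hjmin k (by omega)
      have h2 := hmaj (k + 1) (by omega)
      have h3 : i < k := by omega
      have h4 : ps π (k + 1) ≠ ps π' (k + 1) := fun h => h1 ⟨h3, h⟩
      omega
  have hjlt : π' j < π j := by
    have := hstrict j hij le_rfl
    rw [ps_succ, ps_succ] at hj
    omega
  have hj1 : 0 < π' j := (hs' j).2 hjn
  have hanti : Antitone π := antitone_nat_of_succ_le hm
  have hdij : π j ≤ π i := hanti hij.le
  let π1 : ℕ → ℕ := fun k => if k = i then π i + 1 else if k = j then π j - 1 else π k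
  have e1 : π1 i = π i + 1 := by simp [π1]
  have e2 : π1 j + 1 = π j := by
    simp only [π1, hij.ne', if_false, if_true]; omega
  have e3 : ∀ k, k ≠ i → k ≠ j → π1 k = π k := by
    intro k h1 h2; simp [π1, h1, h2]
  obtain ⟨G1, t1, r1, lam1, hl1, hlt1⟩ := transfer_step n π π1 i j hin hjn hij.ne hdij (by omega)
    e1 e2 e3 G hG hr lam hlam
  by_cases hfin : π1 = π'
  · rw [hfin] at r1
    exact ⟨G1, t1, r1, lam1, hl1, hlt1⟩
  have hps : ∀ k, ps π1 k = ps π k + if i < k ∧ k ≤ j then 1 else 0 := by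
    intro k
    induction k with
    | zero => simp [ps_zero]
    | succ k ihk =>
      rw [ps_succ, ps_succ, ihk]
      by_cases h1 : k = i
      · subst h1
        rw [e1, if_neg (by omega), if_pos (by omega)]; omega
      by_cases h2 : k = j
      · subst h2
        rw [if_pos (by omega), if_neg (by omega)]; omega
      rw [e3 k h1 h2]
      by_cases h3 : i < k ∧ k ≤ j
      · rw [if_pos h3, if_pos (by omega)]; omega
      · rw [if_neg h3, if_neg (by omega)]; omega
  have hmaj1 : ∀ k ≤ n, ps π1 k ≤ ps π' k := by
    intro k hk
    rw [hps]
    split_ifs with h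
    · exact hstrict k h.1 h.2
    · exact hmaj k hk
  have hs1 : ∀ k, 0 < π1 k ↔ k < n := by
    intro k
    by_cases h1 : k = i
    · subst h1; omega
    by_cases h2 : k = j
    · subst h2; omega
    rw [e3 k h1 h2]; exact hs k
  have hm1 : ∀ k, π1 (k + 1) ≤ π1 k := by
    intro k
    have hmk := hm k
    by_cases h1 : k + 1 = i
    · have a1 := himin k (by omega)
      have a2 := hm' k
      rw [e3 k (by omega) (by omega)]
      rw [h1] at a2 ⊢
      omega
    by_cases h2 : k = j
    · subst h2
      rw [e3 (k + 1) (by omega) (by omega)]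
      by_cases h3 : k + 1 < n
      · have a1 := hmaj (k + 1 + 1) h3
        rw [ps_succ, ps_succ π'] at a1
        have a2 := hm' k
        omega
      · have := hs (k + 1)
        omega
    by_cases h3 : k + 1 = j
    · by_cases h4 : k = i
      · subst h4; rw [h3] at hmk ⊢; omega
      · rw [e3 k h4 h2]; rw [h3] at hmk ⊢; omega
    rw [e3 (k + 1) h1 h3]
    by_cases h4 : k = i
    · subst h4; omega
    · rw [e3 k h4 h2]; exact hmk
  have hlt : ∑ k ∈ Finset.range (n + 1), (ps π' k - ps π1 k) < m := by
    rw [← hmeas]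
    refine Finset.sum_lt_sum (fun k hk => ?_) ⟨i + 1, Finset.mem_range.2 (by omega), ?_⟩
    · rw [hps]; omega
    · have := hstrict (i + 1) (by omega) (by omega)
      rw [hps, if_pos (by omega)]; omega
  obtain ⟨G', t', r', lam', hl', hlt'⟩ := ih _ hlt π1 hs1 hm1 hmaj1
    (by rw [hps, if_neg (by omega)]; exact htot) hfin rfl G1 t1 r1 lam1 hl1
  exact ⟨G', t', r', lam', hl', hlt1.trans hlt'⟩

lemma chain_ext (n' : ℕ) (π' : ℕ → ℕ) (hs' : ∀ i, 0 < π' i ↔ i < n')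
    (hm' : ∀ i, π' (i + 1) ≤ π' i) (hsum' : ps π' n' = 2 * (n' - 1)) (d : ℕ) :
    ∀ (n : ℕ) (π : ℕ → ℕ), n + d = n' → (∀ i, 0 < π i ↔ i < n) →
    (∀ i, π (i + 1) ≤ π i) → ps π n = 2 * (n - 1) → (∀ j ≤ n, ps π j ≤ ps π' j) → π ≠ π' →
    ∀ (G : SimpleGraph (Fin n)), G.IsTree → Realizes n π G → ∀ lam, IsMaxEig G lam →
    ∃ G' : SimpleGraph (Fin n'), G'.IsTree ∧ Realizes n' π' G' ∧
      ∃ lam', IsMaxEig G' lam' ∧ lam < lam' := by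
  induction d with
  | zero =>
    intro n π hn hs hm hsum hmaj hne G hG hr lam hlam
    obtain rfl : n = n' := by omega
    exact chain_same n π' hs' hm' _ π hs hm hmaj (hsum.trans hsum'.symm) hne rfl G hG hr lam hlam
  | succ d ih =>
    intro n π hn hs hm hsum hmaj hne G hG hr lam hlam
    have hanti' : Antitone π' := antitone_nat_of_succ_le hm'
    have hn1 : 1 ≤ n := by
      obtain ⟨v⟩ := hG.connected.nonempty
      have := v.2; omega
    have hbig : 2 * n - 1 ≤ ps π' n := by
      by_cases h2 : 2 ≤ π' (n - 1)
      · have : (Finset.range n).card • 2 ≤ ps π' n := by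
          apply Finset.card_nsmul_le_sum
          intro k hk
          rw [Finset.mem_range] at hk
          exact h2.trans (hanti' (by omega))
        simp at this; omega
      · have h3 : ps π' n + ∑ k ∈ Finset.Ico n n', π' k = ps π' n' :=
          Finset.sum_range_add_sum_Ico _ (by omega)
        have h4 : ∑ k ∈ Finset.Ico n n', π' k ≤ (Finset.Ico n n').card • 1 := by
          apply Finset.sum_le_card_nsmul
          intro k hk
          rw [Finset.mem_Ico] at hk
          have : π' k ≤ π' (n - 1) := hanti' (by omega)
          omega
        simp at h4; omega
    have hex : ∃ i, ∀ k, i ≤ k → k < n → ps π (k + 1) < ps π' (k + 1) := by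
      refine ⟨n - 1, fun k h1 h2 => ?_⟩
      obtain rfl : k + 1 = n := by omega
      omega
    obtain ⟨i, hi, himin⟩ : ∃ i, (∀ k, i ≤ k → k < n → ps π (k + 1) < ps π' (k + 1)) ∧
        ∀ l < i, ¬ (∀ k, l ≤ k → k < n → ps π (k + 1) < ps π' (k + 1)) :=
      ⟨Nat.find hex, Nat.find_spec hex, fun k hk => Nat.find_min hex hk⟩
    have hin : i < n := by
      by_contra h
      refine himin (n - 1) (by omega) (fun k h1 h2 => ?_)
      obtain rfl : k + 1 = n := by omega
      omega
    let π1 : ℕ → ℕ := fun k => if k = i then π i + 1 else if k = n then 1 else π k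
    have e1 : π1 i = π i + 1 := by simp [π1]
    have e2 : π1 n = 1 := by simp [π1, hin.ne']
    have e3 : ∀ k, k ≠ i → k ≠ n → π1 k = π k := by
      intro k h1 h2; simp [π1, h1, h2]
    have hpn : π n = 0 := by have := hs n; omega
    obtain ⟨G1, t1, r1, lam1, hl1, hlt1⟩ := pendant_step n π π1 i hin e1 e2
      (fun k h1 h2 => e3 k h2 (by omega)) G hG hr lam hlam
    have hs1 : ∀ k, 0 < π1 k ↔ k < n + 1 := by
      intro k
      by_cases h1 : k = i
      · subst h1; omega
      by_cases h2 : k = n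
      · subst h2; omega
      rw [e3 k h1 h2, hs k]; omega
    by_cases hfin : π1 = π'
    · have hnn : n + 1 = n' := by
        have a1 := hs1 (n + 1)
        have a2 := hs' (n + 1)
        rw [hfin] at a1
        omega
      subst hnn
      rw [hfin] at r1
      exact ⟨G1, t1, r1, lam1, hl1, hlt1⟩
    have hps : ∀ k ≤ n, ps π1 k = ps π k + if i < k then 1 else 0 := by
      intro k
      induction k with
      | zero => simp [ps_zero]
      | succ k ihk =>
        intro hk
        rw [ps_succ, ps_succ, ihk (by omega)]
        by_cases h1 : k = i
        · subst h1
          rw [e1, if_neg (by omega), if_pos (by omega)]; omega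
        rw [e3 k h1 (by omega)]
        by_cases h3 : i < k
        · rw [if_pos h3, if_pos (by omega)]; omega
        · rw [if_neg h3, if_neg (by omega)]; omega
    have hpsn : ps π1 (n + 1) = 2 * n := by
      rw [ps_succ, hps n le_rfl, if_pos hin, e2]; omega
    have hmaj1 : ∀ k ≤ n + 1, ps π1 k ≤ ps π' k := by
      intro k hk
      by_cases hkn : k = n + 1
      · subst hkn
        rw [hpsn, ps_succ]
        have := (hs' n).2 (by omega)
        omega
      rw [hps k (by omega)]
      split_ifs with h
      · obtain ⟨k, rfl⟩ : ∃ l, k = l + 1 := ⟨k - 1, by omega⟩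
        exact hi k (by omega) (by omega)
      · exact hmaj k (by omega)
    have hm1 : ∀ k, π1 (k + 1) ≤ π1 k := by
      intro k
      have hmk := hm k
      by_cases h1 : k + 1 = i
      · have a1 := himin k (by omega)
        push Not at a1
        obtain ⟨l, hl1, hl2, hl3⟩ := a1
        have hlk : l = k := by
          by_contra hne
          have := hi l (by omega) hl2
          omega
        subst hlk
        have a2 := hi (l + 1) (by omega) (by omega)
        have a3 := hmaj l (by omega)
        have a4 := hm' l
        rw [ps_succ, ps_succ π'] at a2
        have a5 := hmaj (l + 1) (by omega)
        rw [e3 l (by omega) (by omega)]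
        have b1 := ps_succ π l
        have b2 := ps_succ π' l
        subst h1
        omega
      by_cases h2 : k = n
      · subst h2
        rw [e3 (k + 1) (by omega) (by omega)]
        omega
      by_cases h3 : k + 1 = n
      · have := (hs1 k).2 (by omega)
        rw [h3, e2]; omega
      rw [e3 (k + 1) h1 h3]
      by_cases h4 : k = i
      · subst h4; omega
      · rw [e3 k h4 h2]; exact hmk
    obtain ⟨G', t', r', lam', hl', hlt'⟩ := ih (n + 1) π1 (by omega) hs1 hm1
      (by rw [hpsn]; omega) hmaj1 hfin G1 t1 r1 lam1 hl1
    exact ⟨G', t', r', lam', hl', hlt1.trans hlt'⟩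

/-- If `π ⊲ π'` are distinct non-increasing tree degree sequences (π of length n,
π' of length n' ≥ n, all partial sums of π bounded by those of π'), and `G`, `G'`
are extremal for `π`, `π'` respectively, then `λ(G) < λ(G')`. -/
theorem stmt13 (n n' : ℕ) (hnn' : n ≤ n') (π π' : ℕ → ℕ)
    (hπsupp : ∀ i, 0 < π i ↔ i < n) (hπ'supp : ∀ i, 0 < π' i ↔ i < n')
    (hπmono : ∀ i j, i ≤ j → π j ≤ π i) (hπ'mono : ∀ i j, i ≤ j → π' j ≤ π' i)
    (hπsum : ∑ i ∈ Finset.range n, π i = 2 * (n - 1))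
    (hπ'sum : ∑ i ∈ Finset.range n', π' i = 2 * (n' - 1))
    (hne : π ≠ π')
    (hmaj : ∀ j < n, ∑ i ∈ Finset.range (j + 1), π i ≤ ∑ i ∈ Finset.range (j + 1), π' i)
    (G : SimpleGraph (Fin n)) (G' : SimpleGraph (Fin n')) (lam lam' : ℝ)
    (hG : ExtremalFor n π G lam) (hG' : ExtremalFor n' π' G' lam') :
    lam < lam' := by
  obtain ⟨hT, hr, hl, -⟩ := hG
  obtain ⟨-, -, -, hmax⟩ := hG'
  obtain ⟨G1, t1, r1, lam1, hl1, hlt⟩ := chain_ext n' π' hπ'supp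
    (fun i => hπ'mono i (i + 1) (Nat.le_succ i)) hπ'sum (n' - n) n π (by omega) hπsupp
    (fun i => hπmono i (i + 1) (Nat.le_succ i)) hπsum (fun j hj => by
      rcases j with _ | j
      · simp [ps_zero]
      · exact hmaj j hj) hne G hT hr lam hl
  exact hlt.trans_le (hmax G1 t1 r1 lam1 hl1)
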